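/- Let $(\Omega,\Sigma,\mu)$ be a probability space, $N \ge 1$, $P = \mu^{\otimes N}$, and let $h : \Omega \times \Omega \to [0,\infty)$ be measurable with $h(\omega,\omega) = 0$ for all $\omega$. Assume $\iint_{\Omega^2} \exp h(x,y)\, d\mu(x) d\mu(y) \le 2$. Then for every measurable $A \subseteq \Omega^N$ with $P(A) > 0$ and every $0 < u \le 2N$: $P^*(\{x : f_h(A,x) \ge u\}) \le \frac{1}{P(A)} e^{-u^2/(4N)}$. -/

import Mathlib

open MeasureTheory ENNReal

/-- The product probability `μ^{⊗N}` on `Ω^N`. -/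
noncomputable def piP {Ω : Type*} [MeasurableSpace Ω] (μ : Measure Ω) [SigmaFinite μ]
    (N : ℕ) : Measure (Fin N → Ω) :=
  Measure.pi fun _ : Fin N => μ

/-- `f_h(A,x) = inf { ∑_{i ≤ N} h(x_i, y_i) : y ∈ A }`. -/
noncomputable def fPenalty {N : ℕ} {Ω : Type*} (h : Ω → Ω → ℝ) (A : Set (Fin N → Ω))
    (x : Fin N → Ω) : ℝ :=
  ⨅ y : A, ∑ i, h (x i) ((y : Fin N → Ω) i)

theorem cosh_mul_le {t : ℝ} (ht0 : 0 ≤ t) (ht1 : t ≤ 1) (x : ℝ) :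
    Real.cosh (t * x) ≤ 1 - t ^ 2 + t ^ 2 * Real.cosh x := by
  have h1 := Real.hasSum_cosh (t * x)
  have h2 := (hasSum_ite_eq (0 : ℕ) (1 - t ^ 2)).add ((Real.hasSum_cosh x).mul_left (t ^ 2))
  refine hasSum_le (fun n => ?_) h1 h2
  rcases Nat.eq_zero_or_pos n with rfl | hn
  · simp
  · have hpow : t ^ (2 * n) ≤ t ^ 2 := pow_le_pow_of_le_one ht0 ht1 (by omega)
    have hx : 0 ≤ x ^ (2 * n) / ((2 * n).factorial : ℝ) :=
      div_nonneg (by rw [pow_mul]; positivity) (by positivity)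
    rw [if_neg hn.ne', zero_add, mul_pow, mul_div_assoc]
    exact mul_le_mul_of_nonneg_right hpow hx

theorem add_exp_neg_le {t : ℝ} (ht0 : 0 ≤ t) (ht1 : t ≤ 1) {x : ℝ} (hx : 0 ≤ x) :
    Real.exp (t * x) + Real.exp (-(t * x)) ≤ 2 + t ^ 2 * (Real.exp x - 1) := by
  have h1 := cosh_mul_le ht0 ht1 x
  rw [Real.cosh_eq, Real.cosh_eq] at h1
  have h2 : Real.exp (-x) ≤ 1 := Real.exp_le_one_iff.2 (by linarith)
  nlinarith [mul_le_mul_of_nonneg_left h2 (sq_nonneg t)]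

theorem add_le_of_mul_le_one {t : ℝ} (ht0 : 0 ≤ t) (ht1 : t ≤ 1) {x a b : ℝ} (hx : 0 ≤ x)
    (ha : 1 ≤ a) (hab : a * b ≤ 1) (hax : a ≤ Real.exp (t * x)) :
    a + b ≤ 2 + t ^ 2 * (Real.exp x - 1) := by
  refine le_trans ?_ (add_exp_neg_le ht0 ht1 hx)
  rw [Real.exp_neg]
  set e := Real.exp (t * x)
  have he : 1 ≤ e := ha.trans hax
  have ha0 : 0 < a := by linarith
  have he0 : 0 < e := by linarith
  have hb : b ≤ a⁻¹ := by rw [← one_div, le_div_iff₀ ha0]; linarith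
  have hinv : a * a⁻¹ = 1 := mul_inv_cancel₀ ha0.ne'
  have hinv' : e * e⁻¹ = 1 := mul_inv_cancel₀ he0.ne'
  have hle : a⁻¹ ≤ 1 := inv_le_one_of_one_le₀ ha
  have hle' : 0 < e⁻¹ := by positivity
  have hle1 : e⁻¹ ≤ 1 := inv_le_one_of_one_le₀ he
  have key : e + e⁻¹ - (a + a⁻¹) = (e - a) * (1 - a⁻¹ * e⁻¹) := by
    linear_combination a⁻¹ * hinv' - e⁻¹ * hinv
  have : 0 ≤ (e - a) * (1 - a⁻¹ * e⁻¹) :=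
    mul_nonneg (by linarith) (by nlinarith)
  linarith

theorem add_le_of_mul_le {t : ℝ} (ht0 : 0 ≤ t) (ht1 : t ≤ 1) {x y a b : ℝ} (hx : 0 ≤ x)
    (hy : 0 ≤ y) (hab : a * b ≤ 1)
    (hax : a ≤ Real.exp (t * x)) (hby : b ≤ Real.exp (t * y)) :
    a + b ≤ 2 + t ^ 2 * (Real.exp x - 1) + t ^ 2 * (Real.exp y - 1) := by
  have hx' : 0 ≤ t ^ 2 * (Real.exp x - 1) :=
    mul_nonneg (sq_nonneg t) (by linarith [Real.one_le_exp hx])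
  have hy' : 0 ≤ t ^ 2 * (Real.exp y - 1) :=
    mul_nonneg (sq_nonneg t) (by linarith [Real.one_le_exp hy])
  rcases le_total 1 a with ha | ha
  · linarith [add_le_of_mul_le_one ht0 ht1 hx ha hab hax]
  · rcases le_total 1 b with hb | hb
    · linarith [add_le_of_mul_le_one ht0 ht1 hy hb (by rwa [mul_comm]) hby]
    · linarith

theorem ennreal_add_le_of_mul_le {t : ℝ} (ht0 : 0 ≤ t) (ht1 : t ≤ 1) {x y : ℝ} (hx : 0 ≤ x)
    (hy : 0 ≤ y) {C : ℝ} (hC : 0 < C) {a b : ℝ≥0∞}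
    (hab : a * b ≤ ENNReal.ofReal C * ENNReal.ofReal C)
    (hax : a ≤ ENNReal.ofReal (Real.exp (t * x)) * ENNReal.ofReal C)
    (hby : b ≤ ENNReal.ofReal (Real.exp (t * y)) * ENNReal.ofReal C) :
    a + b ≤ ENNReal.ofReal C * (2 + ENNReal.ofReal (t ^ 2) * ENNReal.ofReal (Real.exp x - 1)
      + ENNReal.ofReal (t ^ 2) * ENNReal.ofReal (Real.exp y - 1)) := by
  have hx' : 0 ≤ Real.exp x - 1 := by linarith [Real.one_le_exp hx]
  have hy' : 0 ≤ Real.exp y - 1 := by linarith [Real.one_le_exp hy]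
  rw [← ENNReal.ofReal_mul (Real.exp_pos _).le] at hax hby
  lift a to NNReal using ne_top_of_le_ne_top ENNReal.ofReal_ne_top hax
  lift b to NNReal using ne_top_of_le_ne_top ENNReal.ofReal_ne_top hby
  rw [← ENNReal.ofReal_coe_nnreal, ENNReal.ofReal_le_ofReal_iff (by positivity)] at hax hby
  rw [← ENNReal.ofReal_coe_nnreal, ← ENNReal.ofReal_coe_nnreal (p := b),
    ← ENNReal.ofReal_mul hC.le, ← ENNReal.ofReal_mul a.coe_nonneg,
    ENNReal.ofReal_le_ofReal_iff (by positivity)] at hab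
  have key := add_le_of_mul_le ht0 ht1 hx hy (a := a / C) (b := b / C)
    (by rw [div_mul_div_comm, div_le_one (by positivity)]; exact hab)
    ((div_le_iff₀ hC).2 hax) ((div_le_iff₀ hC).2 hby)
  rw [← add_div, div_le_iff₀ hC] at key
  rw [← ENNReal.ofReal_coe_nnreal, ← ENNReal.ofReal_coe_nnreal (p := b),
    ← ENNReal.ofReal_add a.coe_nonneg b.coe_nonneg, ← ENNReal.ofReal_ofNat 2,
    ← ENNReal.ofReal_mul (sq_nonneg t), ← ENNReal.ofReal_mul (sq_nonneg t),
    ← ENNReal.ofReal_add (by positivity) (by positivity),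
    ← ENNReal.ofReal_add (by positivity) (by positivity), ← ENNReal.ofReal_mul hC.le]
  exact ENNReal.ofReal_le_ofReal (by linarith)

theorem measurable_essInf_prod {α β : Type*} [MeasurableSpace α] [MeasurableSpace β]
    {ν : Measure β} [SFinite ν] {f : α → β → ℝ≥0∞} (hf : Measurable (Function.uncurry f)) :
    Measurable fun a => essInf (f a) ν := by
  refine measurable_of_Iio fun c => ?_
  have h1 : MeasurableSet {p : α × β | f p.1 p.2 < c} := measurableSet_lt hf measurable_const
  have h2 : (fun a => essInf (f a) ν) ⁻¹' Set.Iio c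
      = (fun a => ν (Prod.mk a ⁻¹' {p : α × β | f p.1 p.2 < c})) ⁻¹' {0}ᶜ := by
    ext a
    simp only [Set.mem_preimage, Set.mem_Iio, Set.mem_compl_iff, Set.mem_singleton_iff,
      Set.preimage_ofPred_eq]
    rw [← not_le, not_iff_not]
    have h3 : ν {b | f a b < c} = 0 ↔ ∀ᵐ b ∂ν, c ≤ f a b := by
      rw [ae_iff]; simp only [not_le]
    rw [h3]
    exact ⟨fun hc => (ae_essInf_le (f := f a)).mono fun b hb => hc.trans hb,
      fun hc => le_essInf_of_ae_le c hc⟩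
  rw [h2]
  exact measurable_measure_prodMk_left h1 (measurableSet_singleton 0).compl

/-- The one-dimensional inequality: if `G(x) g(x) ≤ C` and `G(x) g(y) ≤ C e^{t h(x,y)}`
almost everywhere, then `∫ G · ∫ g ≤ C e^{t²}`. -/
theorem lintegral_mul_lintegral_le {Ω : Type*} [MeasurableSpace Ω] (μ : Measure Ω)
    [IsProbabilityMeasure μ] {h : Ω → Ω → ℝ} (hmeas : Measurable fun p : Ω × Ω => h p.1 p.2)
    (hnn : ∀ x y, 0 ≤ h x y)
    (hint : ∫⁻ p : Ω × Ω, ENNReal.ofReal (Real.exp (h p.1 p.2)) ∂(μ.prod μ) ≤ 2)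
    {t : ℝ} (ht0 : 0 ≤ t) (ht1 : t ≤ 1) {C : ℝ} (hC : 0 < C) {G g : Ω → ℝ≥0∞}
    (hG : Measurable G) (hg : Measurable g) (hGg : ∀ x, G x * g x ≤ ENNReal.ofReal C)
    (hGh : ∀ x, ∀ᵐ y ∂μ, G x * g y ≤ ENNReal.ofReal (Real.exp (t * h x y)) * ENNReal.ofReal C) :
    (∫⁻ x, G x ∂μ) * ∫⁻ x, g x ∂μ ≤ ENNReal.ofReal (C * Real.exp (t ^ 2)) := by
  set k : Ω × Ω → ℝ≥0∞ := fun p => ENNReal.ofReal (Real.exp (h p.1 p.2) - 1) with hk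
  have hkm : Measurable k := by fun_prop
  have hkint : ∫⁻ p, k p ∂(μ.prod μ) ≤ 1 := by
    have h1 : ∀ p : Ω × Ω, ENNReal.ofReal (Real.exp (h p.1 p.2)) = 1 + k p := fun p => by
      rw [hk, ← ENNReal.ofReal_one, ← ENNReal.ofReal_add zero_le_one
        (by linarith [Real.one_le_exp (hnn p.1 p.2)])]
      congr 1; ring
    simp_rw [h1] at hint
    rw [lintegral_add_left measurable_const, lintegral_one, measure_univ,
      ← one_add_one_eq_two] at hint
    exact (ENNReal.add_le_add_iff_left ENNReal.one_ne_top).1 hint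
  have hkswap : ∫⁻ p, k p.swap ∂(μ.prod μ) ≤ 1 := by
    rwa [lintegral_prod_swap]
  have hae : ∀ᵐ p ∂(μ.prod μ),
      G p.1 * g p.2 ≤ ENNReal.ofReal (Real.exp (t * h p.1 p.2)) * ENNReal.ofReal C := by
    rw [Measure.ae_prod_iff_ae_ae]
    · exact Filter.Eventually.of_forall hGh
    · exact measurableSet_le (by fun_prop) (by fun_prop)
  have hae' : ∀ᵐ p ∂(μ.prod μ),
      G p.2 * g p.1 ≤ ENNReal.ofReal (Real.exp (t * h p.2 p.1)) * ENNReal.ofReal C :=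
    (Measure.measurePreserving_swap (μ := μ) (ν := μ)).quasiMeasurePreserving.ae hae
  have e1 : ∫⁻ p, G p.1 * g p.2 ∂(μ.prod μ) = (∫⁻ x, G x ∂μ) * ∫⁻ x, g x ∂μ :=
    lintegral_prod_mul hG.aemeasurable hg.aemeasurable
  have e2 : ∫⁻ p, G p.2 * g p.1 ∂(μ.prod μ) = (∫⁻ x, G x ∂μ) * ∫⁻ x, g x ∂μ := by
    rw [mul_comm, ← lintegral_prod_mul hg.aemeasurable hG.aemeasurable]
    simp_rw [mul_comm]
  have e3 : 2 * ((∫⁻ x, G x ∂μ) * ∫⁻ x, g x ∂μ) ≤ 2 * ENNReal.ofReal (C * Real.exp (t ^ 2)) := by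
    calc 2 * ((∫⁻ x, G x ∂μ) * ∫⁻ x, g x ∂μ)
        = ∫⁻ p, (G p.1 * g p.2 + G p.2 * g p.1) ∂(μ.prod μ) := by
          rw [lintegral_add_left (by fun_prop), e1, e2, two_mul]
      _ ≤ ∫⁻ p, ENNReal.ofReal C * (2 + ENNReal.ofReal (t ^ 2) * k p
            + ENNReal.ofReal (t ^ 2) * k p.swap) ∂(μ.prod μ) := by
          refine lintegral_mono_ae ?_
          filter_upwards [hae, hae'] with p hp hp'
          refine ennreal_add_le_of_mul_le ht0 ht1 (hnn _ _) (hnn _ _) hC ?_ hp hp'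
          calc G p.1 * g p.2 * (G p.2 * g p.1) = (G p.1 * g p.1) * (G p.2 * g p.2) := by ring
            _ ≤ _ := mul_le_mul' (hGg _) (hGg _)
      _ = ENNReal.ofReal C * (2 + ENNReal.ofReal (t ^ 2) * ∫⁻ p, k p ∂(μ.prod μ)
            + ENNReal.ofReal (t ^ 2) * ∫⁻ p, k p.swap ∂(μ.prod μ)) := by
          rw [lintegral_const_mul _ (by fun_prop), lintegral_add_left (by fun_prop),
            lintegral_add_left (by fun_prop), lintegral_const_mul _ (by fun_prop),
            lintegral_const_mul _ (by fun_prop)]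
          simp
      _ ≤ ENNReal.ofReal C * (2 + ENNReal.ofReal (t ^ 2) * 1 + ENNReal.ofReal (t ^ 2) * 1) := by
          gcongr
      _ = 2 * (ENNReal.ofReal C * ENNReal.ofReal (1 + t ^ 2)) := by
          rw [ENNReal.ofReal_add zero_le_one (sq_nonneg t), ENNReal.ofReal_one]; ring
      _ ≤ 2 * ENNReal.ofReal (C * Real.exp (t ^ 2)) := by
          rw [← ENNReal.ofReal_mul hC.le]
          gcongr
          linarith [Real.add_one_le_exp (t ^ 2)]
  exact (ENNReal.mul_le_mul_iff_right two_ne_zero ENNReal.ofNat_ne_top).1 e3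

/-- Parametrized form of the exponential moment bound: for the sections `A_s` of a measurable set,
`x ↦ e^{t f_h(A_s, x)}` has a majorant, jointly measurable in `(s, x)`, whose integral is at most
`e^{n t²} / P(A_s)`. -/
theorem exists_measurable_majorant.{w} {Ω : Type w} [MeasurableSpace Ω] (μ : Measure Ω)
    [IsProbabilityMeasure μ] {h : Ω → Ω → ℝ} (hmeas : Measurable fun p : Ω × Ω => h p.1 p.2)
    (hnn : ∀ x y, 0 ≤ h x y) (hdiag : ∀ ω, h ω ω = 0)
    (hint : ∫⁻ p : Ω × Ω, ENNReal.ofReal (Real.exp (h p.1 p.2)) ∂(μ.prod μ) ≤ 2)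
    {t : ℝ} (ht0 : 0 ≤ t) (ht1 : t ≤ 1) (n : ℕ) :
    ∀ {S : Type w} [MeasurableSpace S] {A : Set (S × (Fin n → Ω))}, MeasurableSet A →
      ∃ F : S × (Fin n → Ω) → ℝ≥0∞, Measurable F ∧
        (∀ s x c, (∀ y, (s, y) ∈ A →
          c ≤ ENNReal.ofReal (Real.exp (t * ∑ i, h (x i) (y i)))) → c ≤ F (s, x)) ∧
        ∀ s, (∫⁻ x, F (s, x) ∂piP μ n) * piP μ n (Prod.mk s ⁻¹' A)
          ≤ ENNReal.ofReal (Real.exp (n * t ^ 2)) := by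
  induction n with
  | zero =>
    intro S _ A hA
    classical
    refine ⟨fun p => if p ∈ A then 1 else ⊤, Measurable.ite hA measurable_const measurable_const,
      fun s x c hc => ?_, fun s => ?_⟩
    · dsimp only
      split_ifs with hx
      · simpa using hc x hx
      · exact le_top
    · rw [piP, Measure.pi_of_empty _ isEmptyElim, lintegral_dirac, Measure.dirac_apply' _
        (measurable_prodMk_left hA)]
      by_cases hs : (s, (isEmptyElim : Fin 0 → Ω)) ∈ A <;> simp [hs]
  | succ n ih =>
    intro S _ A hA
    have hcons : Measurable fun q : (S × Ω) × (Fin n → Ω) =>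
        (q.1.1, (Fin.cons q.1.2 q.2 : Fin (n + 1) → Ω)) := by
      refine measurable_fst.fst.prodMk (measurable_pi_iff.2 fun i => ?_)
      refine Fin.cases ?_ (fun j => ?_) i
      · simpa using measurable_fst.snd
      · simpa [Function.comp_def] using (measurable_pi_apply j).comp measurable_snd
    obtain ⟨F, hF, hFle, hFint⟩ := ih (hcons hA)
    set E : Ω → Ω → ℝ≥0∞ := fun ω ω' => ENNReal.ofReal (Real.exp (t * h ω ω')) with hE
    have hEm : Measurable fun p : Ω × Ω => E p.1 p.2 := by fun_prop
    set K : S → Ω → (Fin n → Ω) → ℝ≥0∞ := fun s ω x =>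
      min (F ((s, ω), x)) (essInf (fun ω' => E ω ω' * F ((s, ω'), x)) μ) with hK
    have hKm : Measurable fun q : S × Ω × (Fin n → Ω) => K q.1 q.2.1 q.2.2 := by
      refine Measurable.min (by fun_prop) ?_
      refine measurable_essInf_prod
        (f := fun (q : S × Ω × (Fin n → Ω)) ω' => E q.2.1 ω' * F ((q.1, ω'), q.2.2)) ?_
      refine Measurable.mul ?_ ?_
      · exact hEm.comp (by fun_prop : Measurable fun p : (S × Ω × (Fin n → Ω)) × Ω =>
          (p.1.2.1, p.2))
      · exact hF.comp (by fun_prop)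
    have htail : Measurable fun x : Fin (n + 1) → Ω => Fin.tail x :=
      measurable_pi_iff.2 fun i => measurable_pi_apply i.succ
    refine ⟨fun q => K q.1 (q.2 0) (Fin.tail q.2), ?_, fun s x c hc => ?_, fun s => ?_⟩
    · exact hKm.comp (measurable_fst.prodMk (((measurable_pi_apply 0).comp measurable_snd).prodMk
        (htail.comp measurable_snd)))
    · have main : ∀ ω', c ≤ E (x 0) ω' * F ((s, ω'), Fin.tail x) := fun ω' => by
        have hE0 : E (x 0) ω' ≠ 0 := by simp [hE, Real.exp_pos]
        have hEt : E (x 0) ω' ≠ ⊤ := ENNReal.ofReal_ne_top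
        rw [mul_comm, ← ENNReal.div_le_iff hE0 hEt]
        refine hFle _ _ _ fun y hy => ?_
        rw [ENNReal.div_le_iff hE0 hEt]
        refine (hc _ hy).trans_eq ?_
        rw [hE, ← ENNReal.ofReal_mul (Real.exp_pos _).le, ← Real.exp_add, Fin.sum_univ_succ]
        simp only [Fin.cons_zero, Fin.cons_succ, Fin.tail]
        congr 2; ring
      refine le_min ?_ (le_essInf_of_ae_le c (Filter.Eventually.of_forall main))
      simpa [hE, hdiag] using main (x 0)
    · have hmp := measurePreserving_piFinSuccAbove (fun _ : Fin (n + 1) => μ) 0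
      set e := MeasurableEquiv.piFinSuccAbove (fun _ : Fin (n + 1) => Ω) 0
      have hKs : Measurable fun p : Ω × (Fin n → Ω) => K s p.1 p.2 :=
        hKm.comp measurable_prodMk_left
      have i1 : ∫⁻ x, K s (x 0) (Fin.tail x) ∂piP μ (n + 1)
          = ∫⁻ ω, ∫⁻ x, K s ω x ∂piP μ n ∂μ := by
        have := hmp.lintegral_comp hKs
        rw [lintegral_prod _ hKs.aemeasurable] at this
        exact this
      have i2 : piP μ (n + 1) (Prod.mk s ⁻¹' A)
          = ∫⁻ ω, piP μ n (Prod.mk (s, ω) ⁻¹' ((fun q : (S × Ω) × (Fin n → Ω) =>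
              (q.1.1, (Fin.cons q.1.2 q.2 : Fin (n + 1) → Ω))) ⁻¹' A)) ∂μ := by
        have hA' : MeasurableSet (Prod.mk s ⁻¹' A) := measurable_prodMk_left hA
        have := (hmp.symm e).measure_preimage hA'.nullMeasurableSet
        rw [piP, ← this, Measure.prod_apply (e.symm.measurable hA')]
        refine lintegral_congr fun ω => congrArg (piP μ n) (Set.ext fun x => ?_)
        have hsymm : e.symm (ω, x) = Fin.cons ω x := Fin.insertNth_zero (α := fun _ => Ω) ω x
        simp only [Set.mem_preimage, hsymm]
      have : IsProbabilityMeasure (piP μ n) := by unfold piP; infer_instance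
      dsimp only
      rw [i1, i2]
      have hC : Real.exp ((n + 1 : ℕ) * t ^ 2) = Real.exp (n * t ^ 2) * Real.exp (t ^ 2) := by
        rw [← Real.exp_add]; congr 1; push_cast; ring
      rw [hC]
      refine lintegral_mul_lintegral_le μ hmeas hnn hint ht0 ht1 (Real.exp_pos _)
        hKs.lintegral_prod_right' ?_ (fun ω => ?_) (fun ω => ?_)
      · exact (measurable_measure_prodMk_left (hcons hA)).comp measurable_prodMk_left
      · refine le_trans ?_ (hFint (s, ω))
        gcongr
        exact min_le_left _ _
      · have hae : ∀ᵐ ω' ∂μ, ∀ᵐ x ∂piP μ n, K s ω x ≤ E ω ω' * F ((s, ω'), x) := by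
          have hms : MeasurableSet {p : (Fin n → Ω) × Ω |
              K s ω p.1 ≤ E ω p.2 * F ((s, p.2), p.1)} := by
            refine measurableSet_le (hKs.comp (by fun_prop :
              Measurable fun p : (Fin n → Ω) × Ω => (ω, p.1))) (Measurable.mul ?_ ?_)
            · exact hEm.comp (by fun_prop : Measurable fun p : (Fin n → Ω) × Ω => (ω, p.2))
            · exact hF.comp (by fun_prop)
          rw [← Measure.ae_ae_comm hms]
          refine Filter.Eventually.of_forall fun x => ?_
          filter_upwards [ae_essInf_le (μ := μ) (f := fun ω' => E ω ω' * F ((s, ω'), x))]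
            with ω' hω'
          exact (min_le_right _ _).trans hω'
        filter_upwards [hae] with ω' hω'
        calc _ ≤ (∫⁻ x, E ω ω' * F ((s, ω'), x) ∂piP μ n) * _ := by
              gcongr ?_ * _
              exact lintegral_mono_ae hω'
          _ ≤ _ := by
              rw [lintegral_const_mul _ (by fun_prop), mul_assoc]
              gcongr
              exact hFint (s, ω')

/-- Corollary 2.4.4 of Talagrand: if `∬ e^h dμ dμ ≤ 2`, then for every measurable `A`
with `P(A) > 0` and every `0 < u ≤ 2N`,
`P*(f_h(A,·) ≥ u) ≤ (1/P(A)) e^{-u²/(4N)}` (outer probability: in Mathlib a measure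
applied to an arbitrary set is its outer-measure value). -/
theorem talagrand_stmt5 {Ω : Type*} [MeasurableSpace Ω] (μ : Measure Ω)
    [IsProbabilityMeasure μ] (N : ℕ) (hN : 1 ≤ N)
    (h : Ω → Ω → ℝ) (hmeas : Measurable fun p : Ω × Ω => h p.1 p.2)
    (hnn : ∀ x y, 0 ≤ h x y) (hdiag : ∀ ω, h ω ω = 0)
    (hint : ∫⁻ p : Ω × Ω, ENNReal.ofReal (Real.exp (h p.1 p.2)) ∂(μ.prod μ) ≤ 2)
    (A : Set (Fin N → Ω)) (hA : MeasurableSet A) (hA0 : 0 < piP μ N A)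
    (u : ℝ) (hu0 : 0 < u) (hu2 : u ≤ 2 * N) :
    piP μ N {x | u ≤ fPenalty h A x} ≤
      (piP μ N A)⁻¹ * ENNReal.ofReal (Real.exp (-u ^ 2 / (4 * N))) := by
  have hN0 : (0 : ℝ) < N := by exact_mod_cast hN
  set t : ℝ := u / (2 * N) with ht
  have ht0 : 0 ≤ t := by positivity
  have ht1 : t ≤ 1 := (div_le_one (by positivity)).2 hu2
  have : IsProbabilityMeasure (piP μ N) := by unfold piP; infer_instance
  have hA0' : piP μ N A ≠ 0 := hA0.ne'
  obtain ⟨ω₀⟩ : Nonempty Ω := μ.nonempty_of_neZero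
  obtain ⟨F, hF, hFle, hFint⟩ := exists_measurable_majorant μ hmeas hnn hdiag hint ht0 ht1 N
    (S := Ω) (measurable_snd hA)
  have hI : (∫⁻ x, F (ω₀, x) ∂piP μ N) * piP μ N A ≤ ENNReal.ofReal (Real.exp (N * t ^ 2)) :=
    hFint ω₀
  have hsub : {x | u ≤ fPenalty h A x} ⊆ {x | ENNReal.ofReal (Real.exp (t * u)) ≤ F (ω₀, x)} := by
    intro x hx
    refine hFle _ _ _ fun y hy => ENNReal.ofReal_le_ofReal (Real.exp_le_exp.2 ?_)
    have hbdd : BddBelow (Set.range fun y : A => ∑ i, h (x i) ((y : Fin N → Ω) i)) :=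
      ⟨0, by rintro _ ⟨y, rfl⟩; exact Finset.sum_nonneg fun i _ => hnn _ _⟩
    exact mul_le_mul_of_nonneg_left (le_trans hx (ciInf_le hbdd ⟨y, hy⟩)) ht0
  have hmarkov := mul_meas_ge_le_lintegral (μ := piP μ N)
    (hF.comp (measurable_prodMk_left (x := ω₀)))
    (ENNReal.ofReal (Real.exp (t * u)))
  have hexp : Real.exp (-u ^ 2 / (4 * N)) = Real.exp (N * t ^ 2) * Real.exp (-(t * u)) := by
    rw [← Real.exp_add]
    congr 1
    rw [ht]
    field_simp
    ring
  rw [mul_comm, ← div_eq_mul_inv, ENNReal.le_div_iff_mul_le (Or.inl hA0')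
    (Or.inl (measure_ne_top _ _)), hexp, Real.exp_neg, ← div_eq_mul_inv,
    ENNReal.ofReal_div_of_pos (Real.exp_pos _), ENNReal.le_div_iff_mul_le
    (Or.inl (by simp [Real.exp_pos])) (Or.inl ENNReal.ofReal_ne_top)]
  calc piP μ N {x | u ≤ fPenalty h A x} * piP μ N A * ENNReal.ofReal (Real.exp (t * u))
      = (ENNReal.ofReal (Real.exp (t * u)) * piP μ N {x | u ≤ fPenalty h A x}) * piP μ N A := by
        ring
    _ ≤ (∫⁻ x, F (ω₀, x) ∂piP μ N) * piP μ N A := by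
        gcongr
        exact le_trans (mul_le_mul_right (measure_mono hsub) _) hmarkov
    _ ≤ _ := hI
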